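/- Let X₀ be a random variable with the exponential distribution of rate 1 (equivalently, the gamma distribution with shape 1 and rate 1) and let U be uniformly distributed on (0,1), independent of X₀. Define Y₁ = X₀ - ln U and Y₂ = X₀ - ln(1-U). Then the correlation coefficient ρ(Y₁,Y₂) equals (2 - π²/6)/2. -/

import Mathlib

open Real MeasureTheory ProbabilityTheory

lemma aux_ftc (F f : ℝ → ℝ) (hc : Continuous F)
    (hd : ∀ x ∈ Set.Ioo (0:ℝ) 1, HasDerivAt F (f x) x)
    (hp : ∀ x ∈ Set.Ioo (0:ℝ) 1, 0 ≤ f x) :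
    IntervalIntegrable f volume 0 1 ∧ ∫ x in (0:ℝ)..1, f x = F 1 - F 0 := by
  have h1 : IntervalIntegrable f volume 0 1 := by
    apply intervalIntegral.intervalIntegrable_deriv_of_nonneg (g := F) hc.continuousOn
    · simpa using hd
    · simpa using hp
  exact ⟨h1, intervalIntegral.integral_eq_sub_of_hasDerivAt_of_le zero_le_one hc.continuousOn hd h1⟩

lemma aux_pow_log (n : ℕ) :
    IntervalIntegrable (fun x : ℝ => x ^ n * (-Real.log x)) volume 0 1 ∧
      ∫ x in (0:ℝ)..1, x ^ n * (-Real.log x) = 1 / ((n:ℝ) + 1) ^ 2 := by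
  have hn : (n:ℝ) + 1 ≠ 0 := by positivity
  have h := aux_ftc (fun x => x ^ (n + 1) / ((n:ℝ) + 1) ^ 2 - x ^ n * (x * Real.log x) / ((n:ℝ) + 1))
    (fun x => x ^ n * (-Real.log x))
    (by have := Real.continuous_mul_log
        fun_prop)
    (by
      intro x hx
      have hx0 : x ≠ 0 := hx.1.ne'
      have e : (fun x : ℝ => x ^ (n + 1) / ((n:ℝ) + 1) ^ 2 - x ^ n * (x * Real.log x) / ((n:ℝ) + 1))
          = fun x => x ^ (n + 1) / ((n:ℝ) + 1) ^ 2 - x ^ (n+1) * Real.log x / ((n:ℝ) + 1) := by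
        funext y; ring
      rw [e]
      have h1 := hasDerivAt_pow (n+1) x
      have := (h1.div_const (((n:ℝ) + 1) ^ 2)).sub
        ((h1.mul (Real.hasDerivAt_log hx0)).div_const ((n:ℝ) + 1))
      refine this.congr_deriv ?_
      simp only [Nat.add_sub_cancel]
      push_cast
      field_simp
      ring)
    (by
      intro x hx
      have := Real.log_nonpos hx.1.le hx.2.le
      have := hx.1.le
      apply mul_nonneg (by positivity) (by linarith))
  refine ⟨h.1, h.2.trans ?_⟩
  simp

lemma aux_log_sq :
    IntervalIntegrable (fun x : ℝ => (Real.log x) ^ 2) volume 0 1 ∧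
      ∫ x in (0:ℝ)..1, (Real.log x) ^ 2 = 2 := by
  have h := aux_ftc (fun x => x * (Real.log x) ^ 2 - 2 * (x * Real.log x) + 2 * x)
    (fun x => (Real.log x) ^ 2)
    (by
      have h1 := Real.continuous_mul_log
      have h2 : Continuous (fun x : ℝ => x * (Real.log x) ^ 2) := by
        have e : (fun x : ℝ => x * (Real.log x) ^ 2) = fun x =>
            if 0 ≤ x then 4 * (√x * Real.log √x) ^ 2
            else - (4 * (√(-x) * Real.log √(-x)) ^ 2) := by
          funext x
          split_ifs with hx
          · rw [Real.log_sqrt hx, mul_pow, Real.sq_sqrt hx]; ring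
          · have : 0 ≤ -x := by linarith
            rw [Real.log_sqrt this, mul_pow, Real.sq_sqrt this, Real.log_neg_eq_log]; ring
        rw [e]
        have h3 : Continuous (fun x : ℝ => √x * Real.log √x) := h1.comp Real.continuous_sqrt
        apply Continuous.if_le
        · fun_prop
        · have := h3.comp continuous_neg
          exact ((this.pow 2).const_mul 4).neg
        · fun_prop
        · fun_prop
        · intro x hx; subst hx; simp
      fun_prop)
    (by
      intro x hx
      have hx0 : x ≠ 0 := hx.1.ne'
      have hl := Real.hasDerivAt_log hx0
      have hi := hasDerivAt_id x
      have := ((hi.mul (hl.pow 2)).sub ((hi.mul hl).const_mul 2)).add (hi.const_mul 2)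
      refine this.congr_deriv ?_
      simp
      field_simp
      ring)
    (by intro x hx; positivity)
  refine ⟨h.1, h.2.trans ?_⟩
  simp

lemma aux_ii {f : ℝ → ℝ} (h : IntervalIntegrable f volume 0 1) :
    Integrable f (volume.restrict (Set.Ioo (0:ℝ) 1)) :=
  (intervalIntegrable_iff_integrableOn_Ioo_of_le zero_le_one).1 h

lemma aux_int (f : ℝ → ℝ) :
    ∫ x, f x ∂(volume.restrict (Set.Ioo (0:ℝ) 1)) = ∫ x in (0:ℝ)..1, f x := by
  rw [intervalIntegral.integral_of_le zero_le_one, integral_Ioc_eq_integral_Ioo]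

lemma aux_flip {f : ℝ → ℝ} (h : IntervalIntegrable f volume 0 1) :
    IntervalIntegrable (fun x => f (1 - x)) volume 0 1 ∧
    ∫ x in (0:ℝ)..1, f (1 - x) = ∫ x in (0:ℝ)..1, f x := by
  constructor
  · simpa using (h.comp_sub_left 1).symm
  · simp

lemma aux_sum : HasSum (fun n : ℕ => 1 / (((n:ℝ) + 1) * ((n:ℝ) + 2) ^ 2)) (2 - π ^ 2 / 6) := by
  have h1 : HasSum (fun n : ℕ => 1 / ((n:ℝ) + 2) ^ 2) (π ^ 2 / 6 - 1) := by
    have := (hasSum_nat_add_iff' 2).2 hasSum_zeta_two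
    simpa [Finset.sum_range_succ] using this
  have h2 : HasSum (fun n : ℕ => 1 / (((n:ℝ) + 1) * ((n:ℝ) + 2))) 1 := by
    rw [hasSum_iff_tendsto_nat_of_nonneg (fun n => by positivity)]
    have e : ∀ n : ℕ, ∑ i ∈ Finset.range n, 1 / (((i:ℝ) + 1) * ((i:ℝ) + 2))
        = 1 - 1 / ((n:ℝ) + 1) := by
      intro n
      induction n with
      | zero => simp
      | succ k ih =>
        rw [Finset.sum_range_succ, ih]
        push_cast
        field_simp
        ring
    simp_rw [e]
    simpa using (tendsto_one_div_add_atTop_nhds_zero_nat (𝕜 := ℝ)).const_sub 1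
  have e1 : (fun n : ℕ => 1 / (((n:ℝ) + 1) * ((n:ℝ) + 2) ^ 2)) =
      fun n : ℕ => 1 / (((n:ℝ) + 1) * ((n:ℝ) + 2)) - 1 / ((n:ℝ) + 2) ^ 2 := by
    funext n
    field_simp
    ring
  have e2 : (2 - π ^ 2 / 6 : ℝ) = 1 - (π ^ 2 / 6 - 1) := by ring
  rw [e1, e2]
  exact h2.sub h1

lemma aux_cross :
    ∫ x, Real.log x * Real.log (1 - x) ∂(volume.restrict (Set.Ioo (0:ℝ) 1)) = 2 - π ^ 2 / 6 := by
  let F : ℕ → ℝ → ℝ := fun n x => (x ^ (n + 1) * (-Real.log x)) / ((n:ℝ) + 1)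
  have hI : ∀ n, Integrable (F n) (volume.restrict (Set.Ioo (0:ℝ) 1)) := fun n =>
    (aux_ii (aux_pow_log (n+1)).1).div_const _
  have hv : ∀ n, ∫ x, F n x ∂(volume.restrict (Set.Ioo (0:ℝ) 1))
      = 1 / (((n:ℝ) + 1) * ((n:ℝ) + 2) ^ 2) := by
    intro n
    have := (aux_pow_log (n+1)).2
    simp only [F]
    rw [integral_div, aux_int, this]
    push_cast
    field_simp
    ring
  have hnorm : ∀ n, ∫ x, ‖F n x‖ ∂(volume.restrict (Set.Ioo (0:ℝ) 1))
      = 1 / (((n:ℝ) + 1) * ((n:ℝ) + 2) ^ 2) := by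
    intro n
    rw [← hv n]
    apply setIntegral_congr_fun measurableSet_Ioo
    intro x hx
    have h1 := Real.log_nonpos hx.1.le hx.2.le
    have h2 := hx.1.le
    apply Real.norm_of_nonneg
    exact div_nonneg (mul_nonneg (by positivity) (by linarith)) (by positivity)
  have hs := hasSum_integral_of_summable_integral_norm hI
    (by simp_rw [hnorm]; exact aux_sum.summable)
  simp_rw [hv] at hs
  rw [← aux_sum.unique hs |>.symm]
  apply setIntegral_congr_fun measurableSet_Ioo
  intro x hx
  have h := (Real.hasSum_pow_div_log_of_abs_lt_one (x := x)
    (by rw [abs_of_pos hx.1]; exact hx.2)).mul_right (-Real.log x)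
  have h' : HasSum (fun n => F n x) (-Real.log (1 - x) * -Real.log x) := by
    have e : (fun n => F n x) = fun n : ℕ => x ^ (n + 1) / ((n:ℝ) + 1) * -Real.log x := by
      funext n
      simp only [F]
      ring
    rw [e]
    exact h
  beta_reduce
  rw [h'.tsum_eq]
  ring

lemma aux_gamma (n : ℕ) :
    Integrable (fun x : ℝ => x ^ (n + 1)) (gammaMeasure 1 1) ∧
      ∫ x, x ^ (n + 1) ∂(gammaMeasure 1 1) = ((n + 1).factorial : ℝ) := by
  have hm : Measurable (gammaPDF 1 1) := (measurable_gammaPDFReal 1 1).ennreal_ofReal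
  have hlt : ∀ᵐ x ∂(volume : Measure ℝ), gammaPDF 1 1 x < ⊤ := by
    filter_upwards with x
    exact ENNReal.ofReal_lt_top
  have e : (fun x : ℝ => (gammaPDF 1 1 x).toReal • x ^ (n+1)) =
      (Set.Ioi (0:ℝ)).indicator (fun x => Real.exp (-x) * x ^ (((n + 1 : ℕ) + 1 : ℝ) - 1)) := by
    funext x
    rw [gammaPDF, ENNReal.toReal_ofReal (gammaPDFReal_nonneg one_pos one_pos x)]
    rcases lt_trichotomy x 0 with hx | hx | hx
    · simp [gammaPDFReal, hx.not_ge, hx.le, Set.indicator]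
    · subst hx; simp
    · rw [Set.indicator_of_mem (by exact hx), add_sub_cancel_right, Real.rpow_natCast]
      simp [gammaPDFReal, hx.le]
  unfold gammaMeasure
  constructor
  · rw [integrable_withDensity_iff_integrable_smul' hm hlt, e,
      integrable_indicator_iff measurableSet_Ioi]
    exact Real.GammaIntegral_convergent (by positivity)
  · rw [integral_withDensity_eq_integral_toReal_smul hm hlt, e,
      integral_indicator measurableSet_Ioi, ← Real.Gamma_eq_integral (by positivity),
      Real.Gamma_nat_eq_factorial]

lemma aux_gamma1 : Integrable (fun x : ℝ => x) (gammaMeasure 1 1) ∧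
    ∫ x, x ∂(gammaMeasure 1 1) = (1 : ℝ) := by
  have := aux_gamma 0
  simp only [zero_add, pow_one, Nat.factorial_one, Nat.cast_one] at this
  exact this

lemma aux_gamma2 : Integrable (fun x : ℝ => x ^ 2) (gammaMeasure 1 1) ∧
    ∫ x, x ^ 2 ∂(gammaMeasure 1 1) = (2 : ℝ) := by
  have := aux_gamma 1
  simp only [one_add_one_eq_two, Nat.factorial_two, Nat.cast_ofNat] at this
  exact this

lemma aux_expand {Ω : Type*} [MeasureSpace Ω]
    (A B C : Ω → ℝ) (h1 : Integrable (fun ω => A ω ^ 2) ℙ) (h2 : Integrable (fun ω => A ω * B ω) ℙ)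
    (h3 : Integrable (fun ω => A ω * C ω) ℙ) (h4 : Integrable (fun ω => B ω * C ω) ℙ) :
    ∫ ω, (A ω - B ω) * (A ω - C ω) ∂ℙ = ∫ ω, A ω ^ 2 ∂ℙ - ∫ ω, A ω * B ω ∂ℙ
      - ∫ ω, A ω * C ω ∂ℙ + ∫ ω, B ω * C ω ∂ℙ := by
  have h5 : Integrable (fun ω => A ω ^ 2 - A ω * B ω) ℙ := h1.sub h2
  have h6 : Integrable (fun ω => A ω ^ 2 - A ω * B ω - A ω * C ω) ℙ := h5.sub h3
  rw [← integral_sub h1 h2, ← integral_sub h5 h3, ← integral_add h6 h4]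
  congr 1
  funext ω
  ring

theorem stmt_13 {Ω : Type*} [MeasureSpace Ω] [IsProbabilityMeasure (ℙ : Measure Ω)]
    (X₀ U : Ω → ℝ) (hX₀ : Measurable X₀) (hU : Measurable U)
    (hexp : Measure.map X₀ ℙ = gammaMeasure 1 1)
    (hunif : Measure.map U ℙ = volume.restrict (Set.Ioo (0:ℝ) 1))
    (hindep : IndepFun X₀ U ℙ)
    (Y₁ Y₂ : Ω → ℝ)
    (hY₁ : Y₁ = fun ω => X₀ ω - Real.log (U ω))
    (hY₂ : Y₂ = fun ω => X₀ ω - Real.log (1 - U ω)) :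
    ((∫ ω, Y₁ ω * Y₂ ω ∂ℙ) - (∫ ω, Y₁ ω ∂ℙ) * (∫ ω, Y₂ ω ∂ℙ)) /
      Real.sqrt (((∫ ω, Y₁ ω * Y₁ ω ∂ℙ) - (∫ ω, Y₁ ω ∂ℙ) * (∫ ω, Y₁ ω ∂ℙ)) *
        ((∫ ω, Y₂ ω * Y₂ ω ∂ℙ) - (∫ ω, Y₂ ω ∂ℙ) * (∫ ω, Y₂ ω ∂ℙ)))
      = (2 - Real.pi ^ 2 / 6) / 2 := by
  have tX : ∀ f : ℝ → ℝ, Measurable f → Integrable f (gammaMeasure 1 1) →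
      Integrable (fun ω => f (X₀ ω)) ℙ ∧ ∫ ω, f (X₀ ω) ∂ℙ = ∫ x, f x ∂(gammaMeasure 1 1) := by
    intro f hf hi
    rw [← hexp] at hi ⊢
    exact ⟨hi.comp_measurable hX₀,
      (integral_map hX₀.aemeasurable hf.aestronglyMeasurable).symm⟩
  have tU : ∀ f : ℝ → ℝ, Measurable f → Integrable f (volume.restrict (Set.Ioo (0:ℝ) 1)) →
      Integrable (fun ω => f (U ω)) ℙ ∧
        ∫ ω, f (U ω) ∂ℙ = ∫ x, f x ∂(volume.restrict (Set.Ioo (0:ℝ) 1)) := by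
    intro f hf hi
    rw [← hunif] at hi ⊢
    exact ⟨hi.comp_measurable hU,
      (integral_map hU.aemeasurable hf.aestronglyMeasurable).symm⟩
  have a1 : Integrable X₀ ℙ ∧ ∫ ω, X₀ ω ∂ℙ = 1 := by
    have := tX (fun x => x) measurable_id aux_gamma1.1
    exact ⟨this.1, this.2.trans aux_gamma1.2⟩
  have a2 : Integrable (fun ω => X₀ ω ^ 2) ℙ ∧ ∫ ω, X₀ ω ^ 2 ∂ℙ = 2 := by
    have := tX (fun x => x ^ 2) (by fun_prop) aux_gamma2.1
    exact ⟨this.1, this.2.trans aux_gamma2.2⟩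
  have lI : IntervalIntegrable Real.log volume 0 1 := by simp
  have lv : ∫ x in (0:ℝ)..1, Real.log x = -1 := by simp [integral_log]
  have m1 : Measurable (fun x : ℝ => Real.log (1 - x)) := by fun_prop
  have b1 : Integrable (fun ω => Real.log (U ω)) ℙ ∧ ∫ ω, Real.log (U ω) ∂ℙ = -1 := by
    have := tU Real.log Real.measurable_log (aux_ii lI)
    exact ⟨this.1, this.2.trans ((aux_int _).trans lv)⟩
  have c1 : Integrable (fun ω => Real.log (1 - U ω)) ℙ ∧ ∫ ω, Real.log (1 - U ω) ∂ℙ = -1 := by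
    have := tU (fun x => Real.log (1 - x)) m1 (aux_ii (aux_flip lI).1)
    exact ⟨this.1, this.2.trans ((aux_int _).trans ((aux_flip lI).2.trans lv))⟩
  have b2 : Integrable (fun ω => Real.log (U ω) ^ 2) ℙ ∧ ∫ ω, Real.log (U ω) ^ 2 ∂ℙ = 2 := by
    have := tU (fun x => Real.log x ^ 2) (by fun_prop) (aux_ii aux_log_sq.1)
    exact ⟨this.1, this.2.trans ((aux_int _).trans aux_log_sq.2)⟩
  have c2 : Integrable (fun ω => Real.log (1 - U ω) ^ 2) ℙ ∧
      ∫ ω, Real.log (1 - U ω) ^ 2 ∂ℙ = 2 := by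
    have := tU (fun x => Real.log (1 - x) ^ 2) (by fun_prop) (aux_ii (aux_flip aux_log_sq.1).1)
    exact ⟨this.1, this.2.trans ((aux_int _).trans ((aux_flip aux_log_sq.1).2.trans aux_log_sq.2))⟩
  have mB : Measurable (fun ω => Real.log (U ω)) := by fun_prop
  have mC : Measurable (fun ω => Real.log (1 - U ω)) := by fun_prop
  have bcI : Integrable (fun ω => Real.log (U ω) * Real.log (1 - U ω)) ℙ :=
    ((memLp_two_iff_integrable_sq mB.aestronglyMeasurable).2 b2.1).integrable_mul
      ((memLp_two_iff_integrable_sq mC.aestronglyMeasurable).2 c2.1)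
  have bcv : ∫ ω, Real.log (U ω) * Real.log (1 - U ω) ∂ℙ = 2 - π ^ 2 / 6 := by
    rw [← aux_cross, ← hunif]
    exact (integral_map hU.aemeasurable
      (f := fun x => Real.log x * Real.log (1 - x))
      (Measurable.aestronglyMeasurable (by fun_prop))).symm
  have iB : IndepFun X₀ (fun ω => Real.log (U ω)) ℙ :=
    hindep.comp measurable_id Real.measurable_log
  have iC : IndepFun X₀ (fun ω => Real.log (1 - U ω)) ℙ :=
    hindep.comp measurable_id m1
  have abI : Integrable (fun ω => X₀ ω * Real.log (U ω)) ℙ := iB.integrable_mul a1.1 b1.1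
  have acI : Integrable (fun ω => X₀ ω * Real.log (1 - U ω)) ℙ := iC.integrable_mul a1.1 c1.1
  have abv : ∫ ω, X₀ ω * Real.log (U ω) ∂ℙ = -1 := by
    refine (iB.integral_mul_eq_mul_integral hX₀.aestronglyMeasurable
      mB.aestronglyMeasurable).trans ?_
    rw [a1.2, b1.2]; norm_num
  have acv : ∫ ω, X₀ ω * Real.log (1 - U ω) ∂ℙ = -1 := by
    refine (iC.integral_mul_eq_mul_integral hX₀.aestronglyMeasurable
      mC.aestronglyMeasurable).trans ?_
    rw [a1.2, c1.2]; norm_num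
  subst hY₁ hY₂
  simp only
  rw [aux_expand _ _ _ a2.1 abI acI bcI,
    aux_expand _ _ _ a2.1 abI abI (by simpa only [sq] using b2.1),
    aux_expand _ _ _ a2.1 acI acI (by simpa only [sq] using c2.1),
    integral_sub a1.1 b1.1, integral_sub a1.1 c1.1]
  have b2' := b2.2
  have c2' := c2.2
  simp only [sq (Real.log _)] at b2' c2'
  rw [a2.2, abv, acv, bcv, a1.2, b1.2, c1.2, b2', c2']
  have : Real.sqrt ((2 - -1 - -1 + 2 - (1 - -1) * (1 - -1)) *
      (2 - -1 - -1 + 2 - (1 - -1) * (1 - -1))) = 2 := by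
    rw [Real.sqrt_mul_self] <;> norm_num
  rw [this]
  ring
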